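/- Let c be the unique real root of 4x⁴ − 8x³ + 8x² − 8x + 3 in (0,1), let δ₀ be the unique real root of 12x⁴ − 32x³ + 24x² − 4x − 1 in (1,∞), and let α := (1−c)·δ₀ / (1 + c·(δ₀ − 2)). Then 0 < α < 1 and 183α⁴ − 352α³ + 214α² − 40α − 1 = 0. -/

import Mathlib

/-- With `c` the unique root of `4x⁴ − 8x³ + 8x² − 8x + 3` in `(0,1)` and `δ₀` the unique
root of `12x⁴ − 32x³ + 24x² − 4x − 1` in `(1,∞)`, the number
`α := (1−c)·δ₀ / (1 + c·(δ₀ − 2))` lies in `(0,1)` and is a root of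
`183x⁴ − 352x³ + 214x² − 40x − 1`. -/
theorem alpha_from_c_delta0 (c δ₀ : ℝ)
    (hc : 0 < c ∧ c < 1 ∧ 4 * c ^ 4 - 8 * c ^ 3 + 8 * c ^ 2 - 8 * c + 3 = 0)
    (hδ : 1 < δ₀ ∧ 12 * δ₀ ^ 4 - 32 * δ₀ ^ 3 + 24 * δ₀ ^ 2 - 4 * δ₀ - 1 = 0) :
    0 < (1 - c) * δ₀ / (1 + c * (δ₀ - 2)) ∧ (1 - c) * δ₀ / (1 + c * (δ₀ - 2)) < 1 ∧
      183 * ((1 - c) * δ₀ / (1 + c * (δ₀ - 2))) ^ 4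
        - 352 * ((1 - c) * δ₀ / (1 + c * (δ₀ - 2))) ^ 3
        + 214 * ((1 - c) * δ₀ / (1 + c * (δ₀ - 2))) ^ 2
        - 40 * ((1 - c) * δ₀ / (1 + c * (δ₀ - 2))) - 1 = 0 := by
  obtain ⟨hc0, hc1, hp⟩ := hc
  obtain ⟨hd1, hd⟩ := hδ
  have hlo : 56 / 100 < c := by
    by_contra h
    push Not at h
    nlinarith [mul_nonneg (mul_nonneg hc0.le hc0.le) (sub_nonneg.2 h), mul_nonneg hc0.le (sub_nonneg.2 h), sq_nonneg (c * (c - 1)), sq_nonneg (c - 1), sq_nonneg (c ^ 2 - c)]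
  have hhi : c < 57 / 100 := by
    by_contra h
    push Not at h
    have h1 : 0 ≤ (c - 57 / 100) * (1 - c) := mul_nonneg (by linarith) (by linarith)
    nlinarith [mul_nonneg h1 hc0.le, mul_nonneg h1 (mul_pos hc0 hc0).le]
  obtain ⟨e, he⟩ : ∃ e : ℝ, e = (13 - 10 * c + 10 * c ^ 2 - 8 * c ^ 3) / 6 := ⟨_, rfl⟩
  have hc2 : c ^ 2 < 33 / 100 := by nlinarith
  have hc2' : 31 / 100 < c ^ 2 := by nlinarith
  have hc3 : c ^ 3 < 19 / 100 := by nlinarith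
  have hc3' : 17 / 100 < c ^ 3 := by nlinarith
  have he1 : 1 < e := by rw [he]; linarith
  have hep : 12 * e ^ 4 - 32 * e ^ 3 + 24 * e ^ 2 - 4 * e - 1 = 0 := by
    rw [he]
    linear_combination ((1511/108)*c^0 + (-352/9)*c^1 + (2090/27)*c^2 + (-2954/27)*c^3 + (3073/27)*c^4 + (-880/9)*c^5 + (544/9)*c^6 + (-256/9)*c^7 + (256/27)*c^8) * hp
  have hde : δ₀ = e := by
    obtain ⟨x, hx⟩ : ∃ x : ℝ, x = δ₀ - 1 := ⟨_, rfl⟩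
    obtain ⟨y, hy⟩ : ∃ y : ℝ, y = e - 1 := ⟨_, rfl⟩
    have hx0 : 0 < x := by linarith
    have hy0 : 0 < y := by linarith
    have hxp : x * (12 * x ^ 3 + 16 * x ^ 2 - 4) = 1 := by
      rw [hx]; linear_combination hd
    have hyp : y * (12 * y ^ 3 + 16 * y ^ 2 - 4) = 1 := by
      rw [hy]; linear_combination hep
    have h1 : 0 < 12 * x ^ 3 + 16 * x ^ 2 - 4 :=
      pos_of_mul_pos_right (by rw [hxp]; norm_num) hx0.le
    have hQ : 0 < (12 * x ^ 3 + 16 * x ^ 2 - 4) +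
        (12 * (x ^ 2 * y + x * y ^ 2 + y ^ 3) + 16 * (x * y + y ^ 2)) := by positivity
    have h2 : (x - y) * ((12 * x ^ 3 + 16 * x ^ 2 - 4) +
        (12 * (x ^ 2 * y + x * y ^ 2 + y ^ 3) + 16 * (x * y + y ^ 2))) = 0 := by
      linear_combination hxp - hyp
    rcases mul_eq_zero.1 h2 with h | h
    · linarith
    · linarith
  have hden : 0 < 1 + c * (δ₀ - 2) := by nlinarith
  have hα : (1 - c) * δ₀ / (1 + c * (δ₀ - 2)) =
      (229 - 154 * c + 148 * c ^ 2 - 128 * c ^ 3) / 183 := by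
    rw [div_eq_iff hden.ne', hde, he]
    linear_combination ((335/1098)*c^0 + (-139/549)*c^1 + (52/549)*c^2 + (-128/549)*c^3) * hp
  rw [hα]
  refine ⟨?_, ?_, ?_⟩
  · linarith
  · linarith
  · linear_combination ((87900356/6128487)*c^0 + (-80227904/2042829)*c^1 + (465621536/6128487)*c^2 + (-10904576/100467)*c^3 + (681864256/6128487)*c^4 + (-66101248/680943)*c^5 + (124911616/2042829)*c^6 + (-58720256/2042829)*c^7 + (67108864/6128487)*c^8) * hp
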